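/- For every integer l ≥ 2 there exists a λ_l-lacunary sequence N of positive integers such that N(l) contains every integer m ≥ 3^l. -/

import Mathlib

open MeasureTheory Filter Finset Topology

noncomputable section

/-- A sequence of positive integers is `lam`-lacunary if `n (k+1) / n k > lam` for all `k`. -/
def IsLacunary (lam : ℝ) (n : ℕ → ℕ) : Prop :=
  (∀ k, 0 < n k) ∧ ∀ k, lam * (n k : ℝ) < (n (k + 1) : ℝ)

/-- `N(l)`: integers of the form `ε₁ n_{k₁} + ⋯ + ε_l n_{k_l}` with `ε_j = ±1` and
`k₁ > k₂ > ⋯ > k_l`. -/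
def SignedSums (n : ℕ → ℕ) (l : ℕ) : Set ℤ :=
  {m | ∃ (k : Fin l → ℕ) (ε : Fin l → ℤ),
    StrictAnti k ∧ (∀ j, ε j = 1 ∨ ε j = -1) ∧ m = ∑ j, ε j * (n (k j) : ℤ)}

/-- Next term: least natural number exceeding `lam * x`. -/
def nxt (lam : ℝ) (x : ℕ) : ℕ := ⌊lam * (x : ℝ)⌋₊ + 1

/-- Block of `p + 2` terms starting at `a` whose top signed sum is `m`. -/
def blk (lam : ℝ) (p m a i : ℕ) : ℕ :=
  if i < p + 1 then (nxt lam)^[i] a else m + ∑ j ∈ Finset.range (p + 1), (nxt lam)^[j] a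

/-- Starting point of the `t`-th block. -/
def strt (lam : ℝ) (p : ℕ) : ℕ → ℕ
  | 0 => 1
  | t + 1 => nxt lam (blk lam p (3 ^ (p + 2) + t) (strt lam p t) (p + 1))

/-- The sequence. -/
def lacSeq (lam : ℝ) (p k : ℕ) : ℕ :=
  blk lam p (3 ^ (p + 2) + k / (p + 2)) (strt lam p (k / (p + 2))) (k % (p + 2))

theorem nxt_gt (lam : ℝ) (x : ℕ) : lam * (x : ℝ) < (nxt lam x : ℝ) := by
  unfold nxt
  push_cast
  exact Nat.lt_floor_add_one _

theorem nxt_le (lam : ℝ) (h : 0 ≤ lam) (x : ℕ) : (nxt lam x : ℝ) ≤ lam * (x : ℝ) + 1 := by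
  unfold nxt
  push_cast
  have := Nat.floor_le (a := lam * (x : ℝ)) (by positivity)
  linarith

theorem nxt_pos (lam : ℝ) (x : ℕ) : 0 < nxt lam x := Nat.succ_pos _

theorem iter_bounds (lam : ℝ) (h1 : 1 < lam) (h2 : lam < 2) (a i : ℕ) :
    lam ^ i * (a : ℝ) ≤ ((nxt lam)^[i] a : ℕ) ∧
      (((nxt lam)^[i] a : ℕ) : ℝ) ≤ lam ^ i * (a : ℝ) + (2 ^ i - 1) := by
  induction i with
  | zero => simp
  | succ i ih =>
    rw [Function.iterate_succ_apply']
    obtain ⟨ha, hb⟩ := ih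
    have hg := nxt_gt lam ((nxt lam)^[i] a)
    have hle := nxt_le lam (by linarith) ((nxt lam)^[i] a)
    have hp : (1 : ℝ) ≤ 2 ^ i := one_le_pow₀ (by norm_num)
    constructor
    · rw [pow_succ]
      nlinarith
    · rw [pow_succ, pow_succ]
      nlinarith [mul_le_mul_of_nonneg_left hb (by linarith : (0 : ℝ) ≤ lam),
        mul_nonneg (sub_nonneg.2 hp) (sub_nonneg.2 h2.le)]

theorem top_gt (lam : ℝ) (h1 : 1 < lam) (h2 : lam < 2) (p : ℕ)
    (he : lam ^ (p + 1) = ∑ i ∈ Finset.range (p + 1), lam ^ i) (m a : ℕ)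
    (hm : 3 ^ (p + 2) ≤ m) :
    lam * (((nxt lam)^[p] a : ℕ) : ℝ) <
      ((m + ∑ j ∈ Finset.range (p + 1), (nxt lam)^[j] a : ℕ) : ℝ) := by
  have hb := (iter_bounds lam h1 h2 a p).2
  have hs : lam ^ (p + 1) * (a : ℝ) ≤
      ∑ j ∈ Finset.range (p + 1), (((nxt lam)^[j] a : ℕ) : ℝ) := by
    rw [he, Finset.sum_mul]
    exact Finset.sum_le_sum fun j _ => (iter_bounds lam h1 h2 a j).1
  have hm' : (3 : ℝ) ^ (p + 2) ≤ m := by exact_mod_cast hm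
  have hp : (2 : ℝ) ^ p ≤ 3 ^ p := pow_le_pow_left₀ (by norm_num) (by norm_num) p
  have hq : (1 : ℝ) ≤ 2 ^ p := one_le_pow₀ (by norm_num)
  have h3 := mul_le_mul_of_nonneg_left hb (by linarith : (0 : ℝ) ≤ lam)
  have h4 : lam * ((2 : ℝ) ^ p - 1) ≤ 2 * (2 ^ p - 1) :=
    mul_le_mul_of_nonneg_right h2.le (by linarith)
  rw [pow_succ] at hs
  rw [pow_add] at hm'
  push_cast
  nlinarith

theorem lam_lt_two (lam : ℝ) (h1 : 1 < lam) (q : ℕ)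
    (he : lam ^ q = ∑ i ∈ Finset.range q, lam ^ i) : lam < 2 := by
  have h := geom_sum_mul lam q
  rw [← he] at h
  have : 0 < lam ^ q := by positivity
  by_contra hc
  nlinarith [mul_nonneg this.le (sub_nonneg.2 (not_lt.1 hc))]

theorem lacSeq_eq (lam : ℝ) (p t i : ℕ) (hi : i < p + 2) :
    lacSeq lam p ((p + 2) * t + i) = blk lam p (3 ^ (p + 2) + t) (strt lam p t) i := by
  unfold lacSeq
  rw [Nat.mul_add_div (by omega), Nat.mul_add_mod, Nat.mod_eq_of_lt hi, Nat.div_eq_of_lt hi,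
    add_zero]

theorem strt_pos (lam : ℝ) (p t : ℕ) : 0 < strt lam p t := by
  cases t with
  | zero => exact Nat.one_pos
  | succ t => exact nxt_pos _ _

theorem iter_pos (lam : ℝ) (a i : ℕ) (ha : 0 < a) : 0 < (nxt lam)^[i] a := by
  cases i with
  | zero => exact ha
  | succ i => rw [Function.iterate_succ_apply']; exact nxt_pos _ _

theorem blk_pos (lam : ℝ) (p m a i : ℕ) (ha : 0 < a) (hm : 0 < m) : 0 < blk lam p m a i := by
  unfold blk
  split_ifs
  · exact iter_pos _ _ _ ha
  · omega

theorem lacSeq_lac (lam : ℝ) (h1 : 1 < lam) (p : ℕ)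
    (he : lam ^ (p + 1) = ∑ i ∈ Finset.range (p + 1), lam ^ i) : IsLacunary lam (lacSeq lam p) := by
  have h2 := lam_lt_two lam h1 _ he
  refine ⟨fun k => blk_pos _ _ _ _ _ (strt_pos _ _ _) (by positivity), fun k => ?_⟩
  obtain ⟨t, i, hi, rfl⟩ : ∃ t i, i < p + 2 ∧ k = (p + 2) * t + i :=
    ⟨k / (p + 2), k % (p + 2), Nat.mod_lt _ (by omega), (Nat.div_add_mod _ _).symm⟩
  rw [lacSeq_eq _ _ _ _ hi]
  by_cases h : i = p + 1
  · subst h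
    rw [show (p + 2) * t + (p + 1) + 1 = (p + 2) * (t + 1) + 0 by ring,
      lacSeq_eq _ _ _ _ (by omega)]
    have : blk lam p (3 ^ (p + 2) + (t + 1)) (strt lam p (t + 1)) 0 =
        nxt lam (blk lam p (3 ^ (p + 2) + t) (strt lam p t) (p + 1)) := by
      conv_lhs => unfold blk
      simp [strt]
    rw [this]
    exact nxt_gt _ _
  · rw [add_assoc, lacSeq_eq _ _ _ _ (by omega)]
    by_cases h' : i = p
    · subst h'
      have := top_gt lam h1 h2 i he (3 ^ (i + 2) + t) (strt lam i t) (by omega)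
      simpa [blk] using this
    · unfold blk
      rw [if_pos (by omega), if_pos (by omega), Function.iterate_succ_apply']
      exact nxt_gt _ _

theorem lacSeq_sum (lam : ℝ) (p t : ℕ) :
    ((3 ^ (p + 2) + t : ℕ) : ℤ) ∈ SignedSums (lacSeq lam p) (p + 2) := by
  refine ⟨fun j => (p + 2) * t + (p + 1 - j), fun j => if j = 0 then 1 else -1, ?_, ?_, ?_⟩
  · intro a b hab
    have : (a : ℕ) < b := hab
    have := b.2
    dsimp only
    omega
  · intro j
    dsimp only
    split_ifs <;> simp
  · rw [Fin.sum_univ_succ]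
    have h : ∀ j : Fin (p + 1), lacSeq lam p ((p + 2) * t + (p + 1 - (j.succ : ℕ))) =
        (nxt lam)^[p + 1 - 1 - (j : ℕ)] (strt lam p t) := by
      intro j
      have := j.2
      rw [lacSeq_eq _ _ _ _ (by omega)]
      unfold blk
      rw [if_pos (by rw [Fin.val_succ]; omega)]
      rw [Fin.val_succ, show p + 1 - ((j : ℕ) + 1) = p + 1 - 1 - (j : ℕ) by omega]
    have h0 : lacSeq lam p ((p + 2) * t + (p + 1 - ((0 : Fin (p + 2)) : ℕ))) =
        3 ^ (p + 2) + t + ∑ j ∈ Finset.range (p + 1), (nxt lam)^[j] (strt lam p t) := by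
      rw [Fin.val_zero, Nat.sub_zero, lacSeq_eq _ _ _ _ (by omega)]
      simp [blk]
    have h5 := Fin.sum_univ_eq_sum_range
      (fun j => (((nxt lam)^[p + 1 - 1 - j] (strt lam p t) : ℕ) : ℤ)) (p + 1)
    have h6 := Finset.sum_range_reflect
      (fun j => (((nxt lam)^[j] (strt lam p t) : ℕ) : ℤ)) (p + 1)
    simp only [h, h0, Fin.succ_ne_zero, if_true, if_false]
    rw [← Finset.mul_sum, h5, h6]
    push_cast
    ring

/-- **Lemma (sharpness construction).** For every `l ≥ 2` there exists a `λ_l`-lacunary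
sequence `N` of positive integers (where `λ_l > 1` solves `x^{l-1} = x^{l-2} + ⋯ + x + 1`)
such that `N(l)` contains every integer `m ≥ 3^l`. -/
theorem statement16 (l : ℕ) (hl : 2 ≤ l)
    (laml : ℝ) (hlaml : 1 < laml)
    (hlameq : laml ^ (l - 1) = ∑ i ∈ Finset.range (l - 1), laml ^ i) :
    ∃ n : ℕ → ℕ, IsLacunary laml n ∧
      ∀ m : ℤ, (3 : ℤ) ^ l ≤ m → m ∈ SignedSums n l := by
  obtain ⟨p, rfl⟩ : ∃ p, l = p + 2 := ⟨l - 2, by omega⟩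
  refine ⟨lacSeq laml p, lacSeq_lac laml hlaml p hlameq, fun m hm => ?_⟩
  obtain ⟨t, ht⟩ := Int.le.dest hm
  have := lacSeq_sum laml p t
  push_cast at this
  rwa [ht] at this
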